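/- Let n ≥ 1 be an integer. For every x ∈ EuclideanSpace ℝ (Fin n) with x ≠ 0, the pointwise Laplacian of the Bessel potential G_n exists at x and equals G_n(x); that is, for each i the map t ↦ G_n(x + t • e i) is twice differentiable at 0 and ∑_{i=0}^{n−1} iteratedDeriv 2 (fun t : ℝ => G_n (x + t • e i)) 0 = G_n(x). -/

import Mathlib

open MeasureTheory Real Topology

/-- The Bessel potential `G_n` on `ℝⁿ`. -/
noncomputable def besselG (n : ℕ) (x : EuclideanSpace ℝ (Fin n)) : ℝ :=
  ∫ t in Set.Ioi (0 : ℝ), (4 * Real.pi * t) ^ (-(n : ℝ) / 2) *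
    Real.exp (-(‖x‖ ^ 2) / (4 * t) - t)

/-- The integrand `t ^ p * exp (-r / (4 t) - t)` of the radial profile of Bessel potentials. -/
noncomputable def besselKernel (p r t : ℝ) : ℝ :=
  t ^ p * Real.exp (-r / (4 * t) - t)

/-- The integral over `t > 0` of `besselKernel p r t`. -/
noncomputable def besselProfile (p r : ℝ) : ℝ :=
  ∫ t in Set.Ioi (0 : ℝ), besselKernel p r t

lemma besselKernel_nonneg (p r : ℝ) {t : ℝ} (ht : 0 < t) : 0 ≤ besselKernel p r t := by
  unfold besselKernel
  positivity

lemma besselKernel_le_of_le (p : ℝ) {r r' t : ℝ} (hr : r ≤ r') (ht : 0 < t) :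
    besselKernel p r' t ≤ besselKernel p r t := by
  unfold besselKernel
  gcongr

lemma besselKernel_le_rpow_mul_exp_neg (p : ℝ) {r t : ℝ} (hr : 0 < r) (ht : 0 < t) (m : ℕ) :
    besselKernel p r t ≤ (m.factorial * (4 / r) ^ m) * (Real.exp (-t) * t ^ (p + m)) := by
  have h := Real.pow_div_factorial_le_exp (x := r / (4 * t)) (by positivity) m
  have h₁ : Real.exp (-(r / (4 * t))) ≤ m.factorial * (4 / r) ^ m * t ^ m := by
    rw [Real.exp_neg]
    refine (inv_anti₀ (by positivity) h).trans_eq ?_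
    simp only [inv_div, div_pow, mul_pow]
    field_simp
  have hE : Real.exp (-r / (4 * t) - t) = Real.exp (-(r / (4 * t))) * Real.exp (-t) := by
    rw [← Real.exp_add]
    ring_nf
  unfold besselKernel
  rw [hE, Real.rpow_add_natCast ht.ne']
  calc t ^ p * (Real.exp (-(r / (4 * t))) * Real.exp (-t))
      ≤ t ^ p * ((m.factorial * (4 / r) ^ m * t ^ m) * Real.exp (-t)) := by gcongr
    _ = _ := by ring

lemma continuousOn_besselKernel (p r : ℝ) : ContinuousOn (besselKernel p r) (Set.Ioi 0) := by
  unfold besselKernel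
  have h : ∀ t ∈ Set.Ioi (0 : ℝ), t ≠ 0 := fun t ht => ne_of_gt ht
  refine ContinuousOn.mul (continuousOn_id.rpow_const fun t ht => Or.inl (h t ht)) ?_
  refine ContinuousOn.rexp (ContinuousOn.sub (ContinuousOn.div continuousOn_const (by fun_prop) ?_)
    continuousOn_id)
  intro t ht
  have := h t ht
  positivity

lemma aestronglyMeasurable_besselKernel (p r : ℝ) :
    AEStronglyMeasurable (besselKernel p r) (volume.restrict (Set.Ioi 0)) :=
  (continuousOn_besselKernel p r).aestronglyMeasurable measurableSet_Ioi

lemma integrableOn_besselKernel (p : ℝ) {r : ℝ} (hr : 0 < r) :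
    IntegrableOn (besselKernel p r) (Set.Ioi 0) := by
  obtain ⟨m, hm⟩ := exists_nat_gt (-(p + 1))
  have hg := Real.GammaIntegral_convergent (s := p + m + 1) (by linarith)
  refine Integrable.mono' (hg.const_mul (m.factorial * (4 / r) ^ m))
    (aestronglyMeasurable_besselKernel p r) ?_
  filter_upwards [ae_restrict_mem measurableSet_Ioi] with t ht
  rw [Real.norm_of_nonneg (besselKernel_nonneg p r ht), add_sub_cancel_right]
  exact besselKernel_le_rpow_mul_exp_neg p hr ht m

lemma tendsto_besselKernel_nhdsGT_zero (p : ℝ) {r : ℝ} (hr : 0 < r) :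
    Filter.Tendsto (besselKernel p r) (𝓝[>] 0) (𝓝 0) := by
  obtain ⟨m, hm⟩ := exists_nat_gt (-p)
  have hm' : 0 < p + m := by linarith
  have hlim : Filter.Tendsto
      (fun t : ℝ => (m.factorial * (4 / r) ^ m) * (Real.exp (-t) * t ^ (p + m))) (𝓝[>] 0) (𝓝 0) := by
    have hc : ContinuousAt
        (fun t : ℝ => (m.factorial * (4 / r) ^ m) * (Real.exp (-t) * t ^ (p + m))) 0 := by
      have := Real.continuousAt_rpow_const 0 (p + m) (Or.inr hm'.le)
      fun_prop
    have := hc.tendsto.mono_left (nhdsWithin_le_nhds (s := Set.Ioi 0))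
    simpa [Real.zero_rpow hm'.ne'] using this
  refine tendsto_of_tendsto_of_tendsto_of_le_of_le' tendsto_const_nhds hlim ?_ ?_
  · filter_upwards [self_mem_nhdsWithin] with t ht using besselKernel_nonneg p r ht
  · filter_upwards [self_mem_nhdsWithin] with t ht using
      besselKernel_le_rpow_mul_exp_neg p hr ht m

lemma hasDerivAt_besselKernel_param (p r : ℝ) {t : ℝ} (ht : 0 < t) :
    HasDerivAt (fun s => besselKernel p s t) (-(1 / 4) * besselKernel (p - 1) r t) r := by
  unfold besselKernel
  have h := ((((hasDerivAt_id r).neg.div_const (4 * t)).sub_const t).exp).const_mul (t ^ p)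
  refine h.congr_deriv ?_
  rw [Real.rpow_sub_one ht.ne']
  simp only [Pi.neg_apply, id]
  field_simp

lemma hasDerivAt_besselKernel (p r : ℝ) {t : ℝ} (ht : 0 < t) :
    HasDerivAt (besselKernel p r)
      (p * besselKernel (p - 1) r t + r / 4 * besselKernel (p - 2) r t - besselKernel p r t) t := by
  have h₁ : HasDerivAt (fun t : ℝ => -r / (4 * t) - t) (r / (4 * t ^ 2) - 1) t := by
    have := ((hasDerivAt_const t (-r)).div ((hasDerivAt_id t).const_mul 4)
      (by simpa using ht.ne')).sub (hasDerivAt_id t)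
    refine this.congr_deriv ?_
    simp only [id]
    field_simp
    ring
  have h := (Real.hasDerivAt_rpow_const (p := p) (Or.inl ht.ne')).mul h₁.exp
  unfold besselKernel
  refine h.congr_deriv ?_
  have h2 : t ^ (p - 2) = t ^ p / t ^ 2 := by exact_mod_cast Real.rpow_sub_natCast ht.ne' p 2
  rw [h2, Real.rpow_sub_one ht.ne']
  field_simp
  ring

lemma besselProfile_recurrence (p : ℝ) {r : ℝ} (hr : 0 < r) :
    p * besselProfile (p - 1) r + r / 4 * besselProfile (p - 2) r = besselProfile p r := by
  have i0 := integrableOn_besselKernel p hr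
  have i1 := (integrableOn_besselKernel (p - 1) hr).const_mul p
  have i2 := (integrableOn_besselKernel (p - 2) hr).const_mul (r / 4)
  have hderiv : ∀ t ∈ Set.Ioi (0 : ℝ), HasDerivAt (besselKernel p r) _ t :=
    fun t ht => hasDerivAt_besselKernel p r ht
  have i' : IntegrableOn (fun t => p * besselKernel (p - 1) r t +
      r / 4 * besselKernel (p - 2) r t - besselKernel p r t) (Set.Ioi 0) := (i1.add i2).sub i0
  have htop := tendsto_zero_of_hasDerivAt_of_integrableOn_Ioi hderiv i' i0
  have h := integral_Ioi_deriv_mul_eq_sub (u := besselKernel p r) (v := fun _ => 1)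
    (v' := fun _ => 0) (a' := 0) (b' := 0) hderiv (fun t _ => hasDerivAt_const t 1)
    (by simpa [Pi.mul_def, Pi.add_def] using i')
    (by simpa [Pi.mul_def] using tendsto_besselKernel_nhdsGT_zero p hr)
    (by simpa [Pi.mul_def] using htop)
  simp only [mul_one, mul_zero, add_zero, sub_zero] at h
  have hsplit : ∫ t in Set.Ioi (0 : ℝ), (p * besselKernel (p - 1) r t +
      r / 4 * besselKernel (p - 2) r t - besselKernel p r t) =
      p * besselProfile (p - 1) r + r / 4 * besselProfile (p - 2) r - besselProfile p r := by
    refine (integral_sub (i1.add i2) i0).trans (congrArg₂ _ ((integral_add i1 i2).trans ?_) rfl)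
    rw [integral_const_mul, integral_const_mul]
    rfl
  linarith

lemma hasDerivAt_besselProfile (p : ℝ) {r : ℝ} (hr : 0 < r) :
    HasDerivAt (besselProfile p) (-(1 / 4) * besselProfile (p - 1) r) r := by
  have h := hasDerivAt_integral_of_dominated_loc_of_deriv_le
    (μ := volume.restrict (Set.Ioi (0 : ℝ))) (F := besselKernel p)
    (F' := fun s t => -(1 / 4) * besselKernel (p - 1) s t)
    (bound := besselKernel (p - 1) (r / 2)) (s := Set.Ioi (r / 2)) (x₀ := r)
    (Ioi_mem_nhds (by linarith))
    (Filter.Eventually.of_forall fun s => aestronglyMeasurable_besselKernel p s)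
    (integrableOn_besselKernel p hr)
    ((aestronglyMeasurable_besselKernel (p - 1) r).const_mul _)
    (by
      filter_upwards [ae_restrict_mem measurableSet_Ioi] with t ht s hs
      have h₁ := besselKernel_le_of_le (p - 1) (le_of_lt hs) ht
      have h₂ := besselKernel_nonneg (p - 1) s ht
      rw [norm_mul, Real.norm_of_nonneg h₂]
      norm_num
      linarith)
    (integrableOn_besselKernel (p - 1) (by positivity))
    (by
      filter_upwards [ae_restrict_mem measurableSet_Ioi] with t ht s _
      exact hasDerivAt_besselKernel_param p s ht)
  have h' := h.2
  rw [integral_const_mul] at h'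
  exact h'

lemma besselG_eq_besselProfile (n : ℕ) (x : EuclideanSpace ℝ (Fin n)) :
    besselG n x =
      (4 * Real.pi) ^ (-(n : ℝ) / 2) * besselProfile (-(n : ℝ) / 2) (‖x‖ ^ 2) := by
  unfold besselG besselProfile besselKernel
  rw [← integral_const_mul]
  refine setIntegral_congr_fun measurableSet_Ioi fun t ht => ?_
  rw [Real.mul_rpow (by positivity) (le_of_lt ht), mul_assoc]

lemma norm_add_smul_single_sq {n : ℕ} (x : EuclideanSpace ℝ (Fin n)) (i : Fin n) (s : ℝ) :
    ‖x + s • EuclideanSpace.single i (1 : ℝ)‖ ^ 2 = ‖x‖ ^ 2 + 2 * s * x i + s ^ 2 := by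
  rw [norm_add_sq_real, inner_smul_right, EuclideanSpace.inner_single_right, norm_smul]
  simp
  ring

section Line

variable {n : ℕ} (x : EuclideanSpace ℝ (Fin n)) (i : Fin n)

lemma hasDerivAt_besselProfile_line (p : ℝ) {s : ℝ}
    (hs : x + s • EuclideanSpace.single i (1 : ℝ) ≠ 0) :
    HasDerivAt
      (fun s : ℝ => besselProfile p (‖x + s • EuclideanSpace.single i (1 : ℝ)‖ ^ 2))
      (-(1 / 2) * (x i + s) *
        besselProfile (p - 1) (‖x + s • EuclideanSpace.single i (1 : ℝ)‖ ^ 2)) s := by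
  have hq : HasDerivAt (fun s : ℝ => ‖x + s • EuclideanSpace.single i (1 : ℝ)‖ ^ 2)
      (2 * (x i + s)) s := by
    simp only [norm_add_smul_single_sq]
    have := (((hasDerivAt_id s).const_mul 2).mul_const (x i)).const_add (‖x‖ ^ 2)
      |>.add ((hasDerivAt_id s).pow 2)
    refine this.congr_deriv ?_
    simp
    ring
  have h := (hasDerivAt_besselProfile p (pow_pos (norm_pos_iff.2 hs) 2)).comp s hq
  refine h.congr_deriv ?_
  ring

lemma hasDerivAt_besselG_line {s : ℝ} (hs : x + s • EuclideanSpace.single i (1 : ℝ) ≠ 0) :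
    HasDerivAt (fun s : ℝ => besselG n (x + s • EuclideanSpace.single i (1 : ℝ)))
      ((4 * Real.pi) ^ (-(n : ℝ) / 2) * (-(1 / 2) * (x i + s) *
        besselProfile (-(n : ℝ) / 2 - 1) (‖x + s • EuclideanSpace.single i (1 : ℝ)‖ ^ 2))) s := by
  simp only [besselG_eq_besselProfile]
  exact (hasDerivAt_besselProfile_line x i _ hs).const_mul _

variable {x}

lemma eventually_add_smul_single_ne_zero (hx : x ≠ 0) :
    ∀ᶠ s in 𝓝 (0 : ℝ), x + s • EuclideanSpace.single i (1 : ℝ) ≠ 0 := by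
  have hc : Continuous fun s : ℝ => x + s • EuclideanSpace.single i (1 : ℝ) := by fun_prop
  exact hc.continuousAt.eventually_ne (by simpa using hx)

lemma hasDerivAt_deriv_besselG_line (hx : x ≠ 0) :
    HasDerivAt (deriv fun s : ℝ => besselG n (x + s • EuclideanSpace.single i (1 : ℝ)))
      ((4 * Real.pi) ^ (-(n : ℝ) / 2) *
        (-(1 / 2) * besselProfile (-(n : ℝ) / 2 - 1) (‖x‖ ^ 2) +
          1 / 4 * x i ^ 2 * besselProfile (-(n : ℝ) / 2 - 2) (‖x‖ ^ 2))) 0 := by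
  have hlin : HasDerivAt (fun s : ℝ => -(1 / 2) * (x i + s)) (-(1 / 2)) 0 := by
    exact (((hasDerivAt_id (0 : ℝ)).const_add (x i)).const_mul (-(1 / 2))).congr_deriv (mul_one _)
  have h := ((hlin.mul (hasDerivAt_besselProfile_line x i (-(n : ℝ) / 2 - 1) (s := 0)
    (by simpa using hx))).const_mul ((4 * Real.pi) ^ (-(n : ℝ) / 2)))
  refine HasDerivAt.congr_of_eventuallyEq (h.congr_deriv ?_) ?_
  · rw [zero_smul, add_zero, sub_sub, one_add_one_eq_two]
    ring
  · filter_upwards [eventually_add_smul_single_ne_zero i hx] with s hs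
    exact (hasDerivAt_besselG_line x i hs).deriv

end Line

/-- Equation (3.3) of Lemma 3.8: `ΔG_n = G_n` pointwise on `ℝⁿ∖{0}`: at every `x ≠ 0`
each map `t ↦ G_n(x + t eᵢ)` is twice differentiable at `0` and the sum of the second
derivatives equals `G_n(x)`. -/
theorem stmt5 (n : ℕ) (hn : 1 ≤ n) (x : EuclideanSpace ℝ (Fin n)) (hx : x ≠ 0) :
    (∀ i : Fin n,
      (∀ᶠ t in 𝓝 (0 : ℝ), DifferentiableAt ℝ
        (fun s : ℝ => besselG n (x + s • EuclideanSpace.single i (1 : ℝ))) t) ∧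
      DifferentiableAt ℝ
        (deriv fun s : ℝ => besselG n (x + s • EuclideanSpace.single i (1 : ℝ))) 0) ∧
    ∑ i : Fin n,
        iteratedDeriv 2 (fun t : ℝ => besselG n (x + t • EuclideanSpace.single i (1 : ℝ))) 0
      = besselG n x := by
  refine ⟨fun i => ⟨?_, (hasDerivAt_deriv_besselG_line i hx).differentiableAt⟩, ?_⟩
  · filter_upwards [eventually_add_smul_single_ne_zero i hx] with s hs
    exact (hasDerivAt_besselG_line x i hs).differentiableAt
  · have hrec := besselProfile_recurrence (-(n : ℝ) / 2) (pow_pos (norm_pos_iff.2 hx) 2)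
    have hsum : ∑ i : Fin n, x i ^ 2 = ‖x‖ ^ 2 := (EuclideanSpace.real_norm_sq_eq x).symm
    have hterm (i : Fin n) : iteratedDeriv 2
        (fun t : ℝ => besselG n (x + t • EuclideanSpace.single i (1 : ℝ))) 0 =
        deriv (deriv fun t : ℝ => besselG n (x + t • EuclideanSpace.single i (1 : ℝ))) 0 := by
      rw [iteratedDeriv_succ, iteratedDeriv_one]
    simp only [hterm, (hasDerivAt_deriv_besselG_line _ hx).deriv]
    rw [besselG_eq_besselProfile, ← hrec, ← Finset.mul_sum, Finset.sum_add_distrib,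
      Finset.sum_const, Finset.card_univ, Fintype.card_fin, nsmul_eq_mul,
      ← Finset.sum_mul, ← Finset.mul_sum, hsum]
    ring
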